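/- arXiv:2102.06973 — 5 statements merged into one kernel-verified Lean document; each statement's English description precedes it below -/
import Mathlib

section
/- Consider optimistic time-selection regret matching with exact cumulative regrets. Suppose that for each round t = 1,...,T: the link outputs are y^t_φ = Σ_{w ∈ W(φ)} w(t)·max(x^t_{φ,w} + m^t_{φ,w}, 0), where x^1 = 0 and x^{t+1}_{φ,w} = x^t_{φ,w} + w(t)·ρ^t(φ), the m^t_{φ,w} ∈ ℝ are arbitrary prediction values, and z^t = Σ_{φ ∈ Φ} y^t_φ; and suppose the learner's mixed strategy π^t satisfies π^t(s') = (1/z^t)·Σ_{φ ∈ Φ} y^t_φ · Σ_{s : φ(s) = s'} π^t(s) for all s' ∈ S whenever z^t > 0 (π^t is arbitrary when z^t = 0). Then for every deviation φ ∈ Φ and every time selection function w ∈ W(φ), the cumulative time-selected regret satisfies Σ_{t=1}^T w(t)·ρ^t(φ) ≤ sqrt( Σ_{t=1}^T Σ_{φ' ∈ Φ} Σ_{w̄ ∈ W(φ')} ( w̄(t)·ρ^t(φ') − m^t_{φ',w̄} )² ). -/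
/-- One-step growth of the squared positive part, given a prediction `m` of the increment `r`. -/
lemma sq_max_add_le (x m r : ℝ) :
    max (x + r) 0 ^ 2 ≤ max x 0 ^ 2 + 2 * (max (x + m) 0 * r) + (r - m) ^ 2 := by
  rcases le_total (x + r) 0 with h1 | h1 <;> rcases le_total x 0 with h2 | h2 <;>
    rcases le_total (x + m) 0 with h3 | h3 <;>
    simp only [max_eq_left, max_eq_right, h1, h2, h3] <;>
    nlinarith [sq_nonneg (x + r), sq_nonneg (r - m), sq_nonneg m, sq_nonneg x]

/-- If `p` is a fixed point of the normalized weighted sum of the pushforwards by `φ ∈ Φ`, then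
the weighted sum of the instantaneous regrets vanishes. -/
lemma sum_weight_mul_regret_eq_zero {S : Type*} [Fintype S] [DecidableEq S]
    (Φ : Finset (S → S)) (y : (S → S) → ℝ) (p u : S → ℝ) (hz : 0 < ∑ φ ∈ Φ, y φ)
    (hfix : ∀ s', p s' = (1 / ∑ φ ∈ Φ, y φ) *
      ∑ φ ∈ Φ, y φ * ∑ s ∈ Finset.univ.filter (fun s => φ s = s'), p s) :
    ∑ φ ∈ Φ, y φ * ∑ s, p s * (u (φ s) - u s) = 0 := by
  have hfix' : ∀ s', (∑ φ ∈ Φ, y φ) * p s' =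
      ∑ φ ∈ Φ, y φ * ∑ s ∈ Finset.univ.filter (fun s => φ s = s'), p s := by
    intro s'
    conv_lhs => rw [hfix s', ← mul_assoc, mul_one_div_cancel hz.ne', one_mul]
  have hpush : ∀ φ : S → S, ∑ s, p s * u (φ s) =
      ∑ s', u s' * ∑ s ∈ Finset.univ.filter (fun s => φ s = s'), p s := by
    intro φ
    rw [← Finset.sum_fiberwise Finset.univ φ]
    refine Finset.sum_congr rfl fun s' _ => ?_
    rw [Finset.mul_sum]
    refine Finset.sum_congr rfl fun s hs => ?_
    rw [(Finset.mem_filter.1 hs).2, mul_comm]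
  have hsum : ∑ φ ∈ Φ, y φ * ∑ s, p s * u (φ s) = (∑ φ ∈ Φ, y φ) * ∑ s, p s * u s := by
    rw [Finset.sum_congr rfl fun φ _ => congrArg (y φ * ·) (hpush φ)]
    simp only [Finset.mul_sum Finset.univ]
    rw [Finset.sum_comm]
    refine Finset.sum_congr rfl fun s' _ => ?_
    rw [← mul_assoc, hfix' s', Finset.sum_mul]
    exact Finset.sum_congr rfl fun φ _ => by ring
  simp_rw [mul_sub, Finset.sum_sub_distrib, mul_sub, Finset.sum_sub_distrib]
  rw [hsum, Finset.sum_mul, sub_self]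

/-- Optimistic time-selection regret matching with exact cumulative regrets:
for every deviation `φ ∈ Φ` and time selection function `w ∈ W φ`, the cumulative
time-selected regret is bounded by the square root of the sum of squared prediction
errors. Rounds are indexed `0, ..., T-1`. -/
theorem optimistic_time_selection_regret_matching_bound
    {S : Type*} [Fintype S] [Nonempty S] [DecidableEq S]
    (T : ℕ)
    (Φ : Finset (S → S))
    (W : (S → S) → Finset (ℕ → ℝ))
    (hW : ∀ φ ∈ Φ, ∀ w ∈ W φ, ∀ t < T, 0 ≤ w t ∧ w t ≤ 1)
    (π : ℕ → S → ℝ)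
    (hπ0 : ∀ t < T, ∀ s : S, 0 ≤ π t s)
    (hπ1 : ∀ t < T, ∑ s : S, π t s = 1)
    (u : ℕ → S → ℝ)
    (ρ : ℕ → (S → S) → ℝ)
    (hρ : ∀ t < T, ∀ φ : S → S, ρ t φ = ∑ s : S, π t s * (u t (φ s) - u t s))
    (m : ℕ → (S → S) → (ℕ → ℝ) → ℝ)
    (x : ℕ → (S → S) → (ℕ → ℝ) → ℝ)
    (hx0 : ∀ φ w, x 0 φ w = 0)
    (hxsucc : ∀ t < T, ∀ φ w, x (t + 1) φ w = x t φ w + w t * ρ t φ)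
    (y : ℕ → (S → S) → ℝ)
    (hy : ∀ t < T, ∀ φ : S → S, y t φ = ∑ w ∈ W φ, w t * max (x t φ w + m t φ w) 0)
    (z : ℕ → ℝ)
    (hz : ∀ t < T, z t = ∑ φ ∈ Φ, y t φ)
    (hfix : ∀ t < T, 0 < z t → ∀ s' : S,
      π t s' = (1 / z t) *
        ∑ φ ∈ Φ, y t φ * ∑ s ∈ Finset.univ.filter (fun s => φ s = s'), π t s) :
    ∀ φ ∈ Φ, ∀ w ∈ W φ,
      ∑ t ∈ Finset.range T, w t * ρ t φ ≤
        Real.sqrt (∑ t ∈ Finset.range T, ∑ φ' ∈ Φ, ∑ w' ∈ W φ',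
          (w' t * ρ t φ' - m t φ' w') ^ 2) := by
  have hy0 : ∀ t < T, ∀ φ ∈ Φ, 0 ≤ y t φ := fun t ht φ hφ => by
    rw [hy t ht]
    exact Finset.sum_nonneg fun w hw => mul_nonneg (hW φ hφ w hw t ht).1 (le_max_right _ _)
  have horth : ∀ t < T, ∑ φ ∈ Φ, y t φ * ρ t φ = 0 := by
    intro t ht
    rcases (Finset.sum_nonneg (hy0 t ht)).eq_or_lt with h | h
    · refine Finset.sum_eq_zero fun φ hφ => ?_
      rw [(Finset.sum_eq_zero_iff_of_nonneg (hy0 t ht)).1 h.symm φ hφ, zero_mul]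
    · have hfix' := hfix t ht (by rwa [hz t ht])
      rw [hz t ht] at hfix'
      simp_rw [hρ t ht]
      exact sum_weight_mul_regret_eq_zero Φ (y t) (π t) (u t) h hfix'
  have hpot : ∀ t ≤ T, ∑ φ ∈ Φ, ∑ w ∈ W φ, max (x t φ w) 0 ^ 2 ≤
      ∑ i ∈ Finset.range t, ∑ φ ∈ Φ, ∑ w ∈ W φ, (w i * ρ i φ - m i φ w) ^ 2 := by
    intro t
    induction t with
    | zero => simp [hx0]
    | succ t ih =>
      intro ht
      have ht' : t < T := ht
      have hcross : ∑ φ ∈ Φ, ∑ w ∈ W φ, 2 * (max (x t φ w + m t φ w) 0 * (w t * ρ t φ)) = 0 := by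
        refine Eq.trans ?_ (mul_eq_zero_of_right 2 (horth t ht'))
        rw [Finset.mul_sum]
        refine Finset.sum_congr rfl fun φ _ => ?_
        rw [hy t ht', Finset.sum_mul, Finset.mul_sum]
        exact Finset.sum_congr rfl fun w _ => by ring
      have hstep : ∑ φ ∈ Φ, ∑ w ∈ W φ, max (x (t + 1) φ w) 0 ^ 2 ≤
          ∑ φ ∈ Φ, ∑ w ∈ W φ, (max (x t φ w) 0 ^ 2 +
            2 * (max (x t φ w + m t φ w) 0 * (w t * ρ t φ)) + (w t * ρ t φ - m t φ w) ^ 2) := by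
        refine Finset.sum_le_sum fun φ _ => Finset.sum_le_sum fun w _ => ?_
        rw [hxsucc t ht']
        exact sq_max_add_le _ _ _
      simp only [Finset.sum_add_distrib] at hstep
      rw [Finset.sum_range_succ]
      linarith [ih ht'.le]
  have hx : ∀ φ w, ∀ t ≤ T, x t φ w = ∑ i ∈ Finset.range t, w i * ρ i φ := by
    intro φ w t
    induction t with
    | zero => simp [hx0]
    | succ t ih =>
      intro ht
      rw [hxsucc t ht, ih (Nat.le_of_succ_le ht), Finset.sum_range_succ]
  intro φ hφ w hw
  rw [← hx φ w T le_rfl]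
  refine (le_max_left _ 0).trans (Real.le_sqrt_of_sq_le (le_trans ?_ (hpot T le_rfl)))
  calc max (x T φ w) 0 ^ 2 ≤ ∑ w' ∈ W φ, max (x T φ w') 0 ^ 2 :=
        Finset.single_le_sum (f := fun w' => max (x T φ w') 0 ^ 2) (fun _ _ => sq_nonneg _) hw
    _ ≤ _ := Finset.single_le_sum (f := fun φ' => ∑ w' ∈ W φ', max (x T φ' w') 0 ^ 2)
        (fun _ _ => Finset.sum_nonneg fun _ _ => sq_nonneg _) hφ
end

section
/- Consider exact time-selection regret matching: suppose every utility function is bounded, |u^t(s)| ≤ U for all t and s, and that for each round t = 1,...,T the link outputs are y^t_φ = Σ_{w ∈ W(φ)} w(t)·max( Σ_{τ=1}^{t−1} w(τ)·ρ^τ(φ), 0 ), z^t = Σ_{φ ∈ Φ} y^t_φ, and the learner's mixed strategy π^t satisfies π^t(s') = (1/z^t)·Σ_{φ ∈ Φ} y^t_φ · Σ_{s : φ(s) = s'} π^t(s) for all s' ∈ S whenever z^t > 0 (π^t is arbitrary when z^t = 0). Let M* = max_{φ ∈ Φ} |W(φ)| and let ω(Φ) = max_{s ∈ S} |{ φ ∈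 Φ : φ(s) ≠ s }| be the maximal activation of Φ. Then for every deviation φ ∈ Φ and every time selection function w ∈ W(φ), Σ_{t=1}^T w(t)·ρ^t(φ) ≤ 2·U·sqrt( M* · ω(Φ) · T ). -/
/-- The squared positive part grows by at most a linear term plus a quadratic term. -/
theorem sq_posPart_add_le (a b : ℝ) :
    max (a + b) 0 ^ 2 ≤ max a 0 ^ 2 + 2 * (max a 0 * b) + b ^ 2 := by
  rcases le_total a 0 with ha | ha <;> rcases le_total (a + b) 0 with hab | hab <;>
    simp only [max_eq_left, max_eq_right, ha, hab] <;> nlinarith [sq_nonneg (a + b)]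

/-- A stationary distribution of the `y`-weighted mixture of deviations has zero `y`-weighted
instantaneous regret. -/
theorem sum_mul_regret_eq_zero_of_stationary {S : Type*} [Fintype S] [DecidableEq S]
    (Φ : Finset (S → S)) (p v : S → ℝ) (c : (S → S) → ℝ)
    (hp : ∀ s', (∑ φ ∈ Φ, c φ) * p s' =
      ∑ φ ∈ Φ, c φ * ∑ s ∈ Finset.univ.filter (fun s => φ s = s'), p s) :
    ∑ φ ∈ Φ, c φ * ∑ s, p s * (v (φ s) - v s) = 0 := by
  have pushforward (φ : S → S) : ∑ s, p s * v (φ s) =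
      ∑ s', (∑ s ∈ Finset.univ.filter (fun s => φ s = s'), p s) * v s' := by
    rw [← Finset.sum_fiberwise Finset.univ φ]
    refine Finset.sum_congr rfl fun s' _ => ?_
    rw [Finset.sum_mul]
    refine Finset.sum_congr rfl fun s hs => ?_
    rw [(Finset.mem_filter.1 hs).2]
  calc ∑ φ ∈ Φ, c φ * ∑ s, p s * (v (φ s) - v s)
      = ∑ φ ∈ Φ, c φ * ∑ s, p s * v (φ s) - (∑ φ ∈ Φ, c φ) * ∑ s, p s * v s := by
        simp only [mul_sub, Finset.sum_sub_distrib, Finset.sum_mul]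
    _ = ∑ s', (∑ φ ∈ Φ, c φ * ∑ s ∈ Finset.univ.filter (fun s => φ s = s'), p s) * v s'
          - ∑ s', ((∑ φ ∈ Φ, c φ) * p s') * v s' := by
        congr 1
        · simp only [pushforward, Finset.mul_sum, Finset.sum_mul]
          rw [Finset.sum_comm]
          simp only [mul_assoc]
        · simp only [Finset.mul_sum, mul_assoc]
    _ = 0 := by simp only [hp, sub_self]

/-- The squared instantaneous regrets of all deviations sum to at most `4 U ^ 2` times a bound
on the number of deviations that move any given strategy. -/
theorem sum_sq_regret_le {S : Type*} [Fintype S] [DecidableEq S]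
    (Φ : Finset (S → S)) (p v : S → ℝ) (U : ℝ) (n : ℕ)
    (hp0 : ∀ s, 0 ≤ p s) (hp1 : ∑ s, p s = 1) (hv : ∀ s, |v s| ≤ U)
    (hn : ∀ s, (Φ.filter (fun φ => φ s ≠ s)).card ≤ n) :
    ∑ φ ∈ Φ, (∑ s, p s * (v (φ s) - v s)) ^ 2 ≤ 4 * U ^ 2 * n := by
  have sq_diff_le (φ : S → S) (s : S) :
      (v (φ s) - v s) ^ 2 ≤ if φ s ≠ s then 4 * U ^ 2 else 0 := by
    split_ifs with h
    · have h1 := abs_le.1 (hv s)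
      have h2 := abs_le.1 (hv (φ s))
      have h3 : |v (φ s) - v s| ≤ 2 * U := abs_le.2 ⟨by linarith, by linarith⟩
      nlinarith [sq_le_sq' (abs_le.1 h3).1 (abs_le.1 h3).2]
    · simp [not_not.1 h]
  calc ∑ φ ∈ Φ, (∑ s, p s * (v (φ s) - v s)) ^ 2
      ≤ ∑ φ ∈ Φ, ∑ s, p s * (if φ s ≠ s then 4 * U ^ 2 else 0) := by
        refine Finset.sum_le_sum fun φ _ => ?_
        refine (Real.pow_arith_mean_le_arith_mean_pow_of_even Finset.univ p
          (fun s => v (φ s) - v s) (fun s _ => hp0 s) hp1 even_two).trans ?_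
        exact Finset.sum_le_sum fun s _ => mul_le_mul_of_nonneg_left (sq_diff_le φ s) (hp0 s)
    _ = ∑ s, p s * (((Φ.filter (fun φ => φ s ≠ s)).card : ℝ) * (4 * U ^ 2)) := by
        rw [Finset.sum_comm]
        refine Finset.sum_congr rfl fun s _ => ?_
        rw [← Finset.mul_sum, ← Finset.sum_filter, Finset.sum_const, nsmul_eq_mul]
    _ ≤ ∑ s, p s * ((n : ℝ) * (4 * U ^ 2)) := by
        refine Finset.sum_le_sum fun s _ => mul_le_mul_of_nonneg_left ?_ (hp0 s)
        exact mul_le_mul_of_nonneg_right (by exact_mod_cast hn s) (by positivity)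
    _ = 4 * U ^ 2 * n := by rw [← Finset.sum_mul, hp1]; ring


/-- Exact time-selection regret matching: with utilities bounded by `U`, for every
deviation `φ ∈ Φ` and every time selection function `w ∈ W φ`, the cumulative
time-selected regret is at most `2 U √(M* ω(Φ) T)`, where `M*` is the size of the
largest time selection set and `ω(Φ)` is the maximal activation of `Φ`.
Rounds are indexed `0, ..., T-1`. -/
theorem exact_time_selection_regret_matching_bound
    {S : Type*} [Fintype S] [Nonempty S] [DecidableEq S]
    (T : ℕ)
    (Φ : Finset (S → S))
    (W : (S → S) → Finset (ℕ → ℝ))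
    (hW : ∀ φ ∈ Φ, ∀ w ∈ W φ, ∀ t < T, 0 ≤ w t ∧ w t ≤ 1)
    (π : ℕ → S → ℝ)
    (hπ0 : ∀ t < T, ∀ s : S, 0 ≤ π t s)
    (hπ1 : ∀ t < T, ∑ s : S, π t s = 1)
    (u : ℕ → S → ℝ)
    (U : ℝ)
    (hU : ∀ t < T, ∀ s : S, |u t s| ≤ U)
    (ρ : ℕ → (S → S) → ℝ)
    (hρ : ∀ t < T, ∀ φ : S → S, ρ t φ = ∑ s : S, π t s * (u t (φ s) - u t s))
    (y : ℕ → (S → S) → ℝ)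
    (hy : ∀ t < T, ∀ φ : S → S,
      y t φ = ∑ w ∈ W φ, w t * max (∑ τ ∈ Finset.range t, w τ * ρ τ φ) 0)
    (z : ℕ → ℝ)
    (hz : ∀ t < T, z t = ∑ φ ∈ Φ, y t φ)
    (hfix : ∀ t < T, 0 < z t → ∀ s' : S,
      π t s' = (1 / z t) *
        ∑ φ ∈ Φ, y t φ * ∑ s ∈ Finset.univ.filter (fun s => φ s = s'), π t s)
    (Mstar : ℕ)
    (hMstar : Mstar = Φ.sup (fun φ => (W φ).card))
    (ω : ℕ)
    (hω : ω = Finset.univ.sup (fun s : S => (Φ.filter (fun φ => φ s ≠ s)).card)) :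
    ∀ φ ∈ Φ, ∀ w ∈ W φ,
      ∑ t ∈ Finset.range T, w t * ρ t φ ≤
        2 * U * Real.sqrt ((Mstar : ℝ) * (ω : ℝ) * (T : ℝ)) := by
  have cross (t : ℕ) (ht : t < T) : ∑ φ ∈ Φ, y t φ * ρ t φ = 0 := by
    have y_nonneg : ∀ φ ∈ Φ, 0 ≤ y t φ := fun φ hφ => by
      rw [hy t ht]
      exact Finset.sum_nonneg fun w hw => mul_nonneg (hW φ hφ w hw t ht).1 (le_max_right _ _)
    rcases (Finset.sum_nonneg y_nonneg).eq_or_lt with h0 | hpos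
    · have := (Finset.sum_eq_zero_iff_of_nonneg y_nonneg).1 h0.symm
      exact Finset.sum_eq_zero fun φ hφ => by rw [this φ hφ, zero_mul]
    · simp only [hρ t ht]
      refine sum_mul_regret_eq_zero_of_stationary Φ (π t) (u t) (y t) fun s' => ?_
      rw [← hz t ht] at hpos ⊢
      rw [hfix t ht hpos s', ← mul_assoc, mul_one_div_cancel hpos.ne', one_mul]
  have quadratic (t : ℕ) (ht : t < T) :
      ∑ φ ∈ Φ, ∑ w ∈ W φ, (w t * ρ t φ) ^ 2 ≤ Mstar * (4 * U ^ 2 * ω) := by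
    calc ∑ φ ∈ Φ, ∑ w ∈ W φ, (w t * ρ t φ) ^ 2
        ≤ ∑ φ ∈ Φ, (Mstar : ℝ) * ρ t φ ^ 2 := by
          refine Finset.sum_le_sum fun φ hφ => ?_
          have card_le : (W φ).card ≤ Mstar :=
            hMstar ▸ Finset.le_sup (f := fun φ => (W φ).card) hφ
          calc ∑ w ∈ W φ, (w t * ρ t φ) ^ 2 ≤ ∑ w ∈ W φ, ρ t φ ^ 2 := by
                refine Finset.sum_le_sum fun w hw => ?_
                obtain ⟨h0, h1⟩ := hW φ hφ w hw t ht
                rw [mul_pow]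
                exact mul_le_of_le_one_left (sq_nonneg _) (pow_le_one₀ h0 h1)
            _ = (W φ).card * ρ t φ ^ 2 := by rw [Finset.sum_const, nsmul_eq_mul]
            _ ≤ Mstar * ρ t φ ^ 2 := by gcongr
      _ = Mstar * ∑ φ ∈ Φ, ρ t φ ^ 2 := by rw [Finset.mul_sum]
      _ ≤ Mstar * (4 * U ^ 2 * ω) := by
          gcongr
          simp only [hρ t ht]
          exact sum_sq_regret_le Φ (π t) (u t) U ω (hπ0 t ht) (hπ1 t ht) (hU t ht) fun s =>
            hω ▸ Finset.le_sup (f := fun s : S => (Φ.filter (fun φ => φ s ≠ s)).card)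
              (Finset.mem_univ s)
  have potential (t : ℕ) (ht : t ≤ T) :
      ∑ φ ∈ Φ, ∑ w ∈ W φ, max (∑ τ ∈ Finset.range t, w τ * ρ τ φ) 0 ^ 2 ≤
        t * (Mstar * (4 * U ^ 2 * ω)) := by
    induction t with
    | zero => simp
    | succ t ih =>
      have ht' : t < T := ht
      calc ∑ φ ∈ Φ, ∑ w ∈ W φ, max (∑ τ ∈ Finset.range (t + 1), w τ * ρ τ φ) 0 ^ 2
          ≤ ∑ φ ∈ Φ, ∑ w ∈ W φ, (max (∑ τ ∈ Finset.range t, w τ * ρ τ φ) 0 ^ 2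
              + 2 * (max (∑ τ ∈ Finset.range t, w τ * ρ τ φ) 0 * (w t * ρ t φ))
              + (w t * ρ t φ) ^ 2) := by
            refine Finset.sum_le_sum fun φ _ => Finset.sum_le_sum fun w _ => ?_
            rw [Finset.sum_range_succ]
            exact sq_posPart_add_le _ _
        _ = ∑ φ ∈ Φ, ∑ w ∈ W φ, max (∑ τ ∈ Finset.range t, w τ * ρ τ φ) 0 ^ 2
              + 2 * ∑ φ ∈ Φ, y t φ * ρ t φ + ∑ φ ∈ Φ, ∑ w ∈ W φ, (w t * ρ t φ) ^ 2 := by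
            simp only [Finset.sum_add_distrib, ← Finset.mul_sum, hy t ht', Finset.sum_mul]
            congr 3
            refine Finset.sum_congr rfl fun φ _ => Finset.sum_congr rfl fun w _ => ?_
            ring
        _ ≤ (t + 1 : ℕ) * (Mstar * (4 * U ^ 2 * ω)) := by
            rw [cross t ht']
            push_cast
            linarith [ih ht'.le, quadratic t ht']
  intro φ hφ w hw
  rcases Nat.eq_zero_or_pos T with rfl | hT
  · simp
  have U_nonneg : 0 ≤ U := (abs_nonneg _).trans (hU 0 hT (Classical.arbitrary S))
  have sq_le : max (∑ t ∈ Finset.range T, w t * ρ t φ) 0 ^ 2 ≤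
      T * (Mstar * (4 * U ^ 2 * ω)) := by
    refine le_trans ?_ (potential T le_rfl)
    refine (Finset.single_le_sum
      (f := fun w : ℕ → ℝ => max (∑ τ ∈ Finset.range T, w τ * ρ τ φ) 0 ^ 2)
      (fun _ _ => sq_nonneg _) hw).trans ?_
    exact Finset.single_le_sum
      (f := fun φ => ∑ w ∈ W φ, max (∑ τ ∈ Finset.range T, w τ * ρ τ φ) 0 ^ 2)
      (fun _ _ => Finset.sum_nonneg fun _ _ => sq_nonneg _) hφ
  refine (le_max_left _ 0).trans (abs_le_of_sq_le_sq' ?_ (by positivity)).2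
  rw [mul_pow, Real.sq_sqrt (by positivity)]
  linarith
end

section
/- The Blackwell condition holds with equality at a regret matching fixed point: let S be a finite nonempty set, let Φ be a finite set of deviations φ : S → S, let y : Φ → ℝ be nonnegative weights with z = Σ_{φ ∈ Φ} y(φ) > 0, and suppose the mixed strategy π ∈ Δ(S) is a fixed point of the regret matching operator, i.e. π(s') = (1/z)·Σ_{φ ∈ Φ} y(φ)·Σ_{s : φ(s) = s'} π(s) for every s' ∈ S. Then for every function u : S → ℝ, Σ_{φ ∈ Φ} y(φ)·( Σ_{s ∈ S} π(s)·u(φ(s)) − Σ_{s ∈ S} π(s)·u(s) ) = 0. -/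
/-- Change of variables for the pushforward of a weight function along `φ`. -/
theorem sum_mul_comp_eq_sum_fiber_mul {S T R : Type*} [Fintype S] [Fintype T] [DecidableEq T]
    [NonUnitalNonAssocSemiring R] (φ : S → T) (p : S → R) (u : T → R) :
    ∑ s, p s * u (φ s) = ∑ t, (∑ s ∈ Finset.univ.filter (fun s => φ s = t), p s) * u t := by
  rw [← Finset.sum_fiberwise Finset.univ φ]
  refine Finset.sum_congr rfl fun t _ => ?_
  rw [Finset.sum_mul]
  refine Finset.sum_congr rfl fun s hs => ?_
  rw [(Finset.mem_filter.mp hs).2]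

/-- The Blackwell condition holds with equality at a fixed point of the regret
matching operator. -/
theorem blackwell_condition_at_regret_matching_fixed_point
    {S : Type*} [Fintype S] [Nonempty S] [DecidableEq S]
    (Φ : Finset (S → S))
    (y : (S → S) → ℝ)
    (hy : ∀ φ ∈ Φ, 0 ≤ y φ)
    (z : ℝ)
    (hz : z = ∑ φ ∈ Φ, y φ)
    (hzpos : 0 < z)
    (π : S → ℝ)
    (hπ0 : ∀ s : S, 0 ≤ π s)
    (hπ1 : ∑ s : S, π s = 1)
    (hfix : ∀ s' : S,
      π s' = (1 / z) *
        ∑ φ ∈ Φ, y φ * ∑ s ∈ Finset.univ.filter (fun s => φ s = s'), π s) :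
    ∀ u : S → ℝ,
      ∑ φ ∈ Φ, y φ * ((∑ s : S, π s * u (φ s)) - ∑ s : S, π s * u s) = 0 := by
  intro u
  have hmul : ∀ t, ∑ φ ∈ Φ, y φ * ∑ s ∈ Finset.univ.filter (fun s => φ s = t), π s = z * π t := by
    intro t
    rw [hfix t, ← mul_assoc, mul_one_div_cancel hzpos.ne', one_mul]
  simp_rw [mul_sub, Finset.sum_sub_distrib, ← Finset.sum_mul, ← hz]
  rw [sub_eq_zero, Finset.sum_congr rfl fun φ _ =>
    congrArg (y φ * ·) (sum_mul_comp_eq_sum_fiber_mul φ π u)]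
  simp only [Finset.mul_sum Finset.univ]
  rw [Finset.sum_comm]
  refine Finset.sum_congr rfl fun t _ => ?_
  simp_rw [← mul_assoc, ← Finset.sum_mul, hmul]
end

section
/- Maximal activation bound on the sum of squared regrets: let S be a finite nonempty set, let Φ be a finite set of deviations φ : S → S, let π ∈ Δ(S) be a mixed strategy, and let u : S → ℝ satisfy |u(s)| ≤ U for all s ∈ S. Let ω(Φ) = max_{s ∈ S} |{ φ ∈ Φ : φ(s) ≠ s }| be the maximal activation of Φ. Then Σ_{φ ∈ Φ} ( Σ_{s ∈ S} π(s)·( u(φ(s)) − u(s) ) )² ≤ 4·U²·ω(Φ). -/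
/-- Maximal activation bound: the sum of squared instantaneous regrets over a finite
set of deviations is at most `4 U² ω(Φ)` where `ω(Φ)` is the maximal activation. -/
theorem sum_squared_regrets_le_maximal_activation
    {S : Type*} [Fintype S] [Nonempty S] [DecidableEq S]
    (Φ : Finset (S → S))
    (π : S → ℝ)
    (hπ0 : ∀ s : S, 0 ≤ π s)
    (hπ1 : ∑ s : S, π s = 1)
    (u : S → ℝ)
    (U : ℝ)
    (hU : ∀ s : S, |u s| ≤ U)
    (ω : ℕ)
    (hω : ω = Finset.univ.sup (fun s : S => (Φ.filter (fun φ => φ s ≠ s)).card)) :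
    ∑ φ ∈ Φ, (∑ s : S, π s * (u (φ s) - u s)) ^ 2 ≤ 4 * U ^ 2 * (ω : ℝ) := by
  have jensen (φ : S → S) :
      (∑ s : S, π s * (u (φ s) - u s)) ^ 2 ≤ ∑ s : S, π s * (u (φ s) - u s) ^ 2 := by
    have h := Finset.sum_sq_le_sum_mul_sum_of_sq_le_mul Finset.univ
      (r := fun s => π s * (u (φ s) - u s)) (f := π)
      (g := fun s => π s * (u (φ s) - u s) ^ 2)
      (fun s _ => hπ0 s) (fun s _ => mul_nonneg (hπ0 s) (sq_nonneg _))
      (fun s _ => le_of_eq (by ring))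
    rwa [hπ1, one_mul] at h
  have pointwise (φ : S → S) (s : S) :
      (u (φ s) - u s) ^ 2 ≤ if φ s ≠ s then 4 * U ^ 2 else 0 := by
    split_ifs with h
    · have h₁ := abs_le.mp (hU (φ s))
      have h₂ := abs_le.mp (hU s)
      nlinarith
    · simp [not_not.mp h]
  have activation (s : S) : ∑ φ ∈ Φ, (u (φ s) - u s) ^ 2 ≤ 4 * U ^ 2 * (ω : ℝ) := by
    have hcard : (Φ.filter (fun φ => φ s ≠ s)).card ≤ ω := by
      rw [hω]
      exact Finset.le_sup (f := fun s : S => (Φ.filter (fun φ => φ s ≠ s)).card)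
        (Finset.mem_univ s)
    calc ∑ φ ∈ Φ, (u (φ s) - u s) ^ 2
        ≤ ∑ φ ∈ Φ, if φ s ≠ s then 4 * U ^ 2 else 0 :=
          Finset.sum_le_sum fun φ _ => pointwise φ s
      _ = 4 * U ^ 2 * ((Φ.filter (fun φ => φ s ≠ s)).card : ℝ) := by
          rw [← Finset.sum_filter, Finset.sum_const, nsmul_eq_mul, mul_comm]
      _ ≤ 4 * U ^ 2 * (ω : ℝ) := by gcongr
  calc ∑ φ ∈ Φ, (∑ s : S, π s * (u (φ s) - u s)) ^ 2
      ≤ ∑ φ ∈ Φ, ∑ s : S, π s * (u (φ s) - u s) ^ 2 :=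
        Finset.sum_le_sum fun φ _ => jensen φ
    _ = ∑ s : S, π s * ∑ φ ∈ Φ, (u (φ s) - u s) ^ 2 := by
        rw [Finset.sum_comm]
        simp_rw [Finset.mul_sum]
    _ ≤ ∑ s : S, π s * (4 * U ^ 2 * (ω : ℝ)) :=
        Finset.sum_le_sum fun s _ => mul_le_mul_of_nonneg_left (activation s) (hπ0 s)
    _ = 4 * U ^ 2 * (ω : ℝ) := by rw [← Finset.sum_mul, hπ1, one_mul]
end

section
/- Any sequence of mixed strategies that can be improved upon by a swap deviation can be improved upon by an internal deviation: let S be a finite nonempty set, let π^1,...,π^T ∈ Δ(S) be mixed strategies and u^1,...,u^T : S → ℝ be utility functions. If there exists a function φ : S → S with Σ_{t=1}^T Σ_{s ∈ S} π^t(s)·( u^t(φ(s)) − u^t(s) ) > 0, then there exist distinct elements s^!, s^∘ ∈ S such that the internal deviation φ^{s^! → s^∘} (which maps s^! to s^∘ and fixes every other element of S) satisfies Σ_{t=1}^T Σ_{s ∈ S} π^t(s)·( u^t(φ^{s^! → s^∘}(s)) − u^t(s) ) > 0, equivalently Σ_{t=1}^T π^t(s^!)·( u^t(s^∘) − u^t(s^!)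 ) > 0. -/
/-- The gain from an internal deviation comes only from the strategy that it moves. -/
theorem sum_mul_internal_deviation_sub {S R : Type*} [Fintype S] [DecidableEq S]
    [NonUnitalNonAssocRing R] (p v : S → R) (a b : S) :
    ∑ s : S, p s * (v (if s = a then b else s) - v s) = p a * (v b - v a) := by
  rw [Fintype.sum_eq_single a fun s hs => by simp [hs], if_pos rfl]

/-- Any sequence of mixed strategies that can be improved upon by a swap deviation can
be improved upon by an internal deviation. Rounds are indexed `0, ..., T-1`. -/
theorem swap_improvement_implies_internal_improvement
    {S : Type*} [Fintype S] [Nonempty S] [DecidableEq S]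
    (T : ℕ)
    (π : ℕ → S → ℝ)
    (hπ0 : ∀ t < T, ∀ s : S, 0 ≤ π t s)
    (hπ1 : ∀ t < T, ∑ s : S, π t s = 1)
    (u : ℕ → S → ℝ)
    (φ : S → S)
    (h : 0 < ∑ t ∈ Finset.range T, ∑ s : S, π t s * (u t (φ s) - u t s)) :
    ∃ sbang sstar : S, sbang ≠ sstar ∧
      0 < ∑ t ∈ Finset.range T, ∑ s : S,
        π t s * (u t (if s = sbang then sstar else s) - u t s) ∧
      0 < ∑ t ∈ Finset.range T, π t sbang * (u t sstar - u t sbang) := by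
  rw [Finset.sum_comm] at h
  obtain ⟨a, -, ha⟩ := Finset.exists_lt_of_sum_lt (Finset.sum_const_zero.trans_lt h)
  refine ⟨a, φ a, fun heq => ?_, ?_, ha⟩
  · simp [← heq] at ha
  · simpa only [sum_mul_internal_deviation_sub] using ha
end
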